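/- Let (Ω, 𝒜, P) be a probability space and Y : [0,∞) → Ω → ℝ^d a process with right-continuous paths and Y(0) = 0 P-almost surely. Let c > 0, let H : (0,∞) → [0,∞), and assume P(sup_{0 ≤ s ≤ h} |Y(s)| ≥ R) ≤ c · h · H(R) for all h > 0 and all R ∈ (0,1]. Let λ > 0 and assume there exists λ' ∈ (0, λ) with lim sup_{R → 0} R^{λ'} H(R) = 0. Then lim_{h ↘ 0} h^{−1/λ} sup_{0 ≤ s ≤ h} |Y(s)| = 0 P-almost surely; in particular, for P-almost every ω and every ε > 0 there exists δ(ω) > 0 such that |Y(h)(ω)| ≤ ε h^{1/λ} for all h ∈ [0, δ(ω)]. -/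

import Mathlib

open MeasureTheory Filter

/-- a maximal-inequality Borel–Cantelli argument: if
`P(sup_{0≤s≤h} |Y(s)| ≥ R) ≤ c·h·H(R)` for all `h > 0`, `R ∈ (0,1]`, and
`R^{λ'} H(R) → 0` as `R → 0` for some `0 < λ' < λ`, then
`h^{-1/λ} sup_{0≤s≤h} |Y(s)| → 0` a.s. as `h ↘ 0`; in particular a.s. for every
`ε > 0` there is `δ > 0` with `|Y(h)| ≤ ε h^{1/λ}` for all `h ∈ [0,δ]`. -/
theorem stmt_19 {Ω : Type*} [MeasurableSpace Ω] (P : Measure Ω)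
    [IsProbabilityMeasure P] (d : ℕ)
    (Y : ℝ → Ω → EuclideanSpace ℝ (Fin d))
    (hY_rc : ∀ ω, ∀ t, 0 ≤ t → ContinuousWithinAt (fun s => Y s ω) (Set.Ici t) t)
    (hY0 : ∀ᵐ ω ∂P, Y 0 ω = 0)
    (c : ℝ) (hc : 0 < c) (H : ℝ → ℝ) (hH_nonneg : ∀ R, 0 < R → 0 ≤ H R)
    (hbound : ∀ h R : ℝ, 0 < h → 0 < R → R ≤ 1 →
      P {ω | R ≤ sSup ((fun s => ‖Y s ω‖) '' Set.Icc 0 h)} ≤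
        ENNReal.ofReal (c * h * H R))
    (lam lam' : ℝ) (hlam : 0 < lam) (hlam' : 0 < lam') (hlam'_lt : lam' < lam)
    (hH_limsup : Tendsto (fun R : ℝ => R ^ lam' * H R)
      (nhdsWithin 0 (Set.Ioi 0)) (nhds 0)) :
    (∀ᵐ ω ∂P, Tendsto
        (fun h : ℝ => h ^ (-(1 / lam)) * sSup ((fun s => ‖Y s ω‖) '' Set.Icc 0 h))
        (nhdsWithin 0 (Set.Ioi 0)) (nhds 0)) ∧
    (∀ᵐ ω ∂P, ∀ ε > (0:ℝ), ∃ δ > (0:ℝ), ∀ h ∈ Set.Icc (0:ℝ) δ,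
      ‖Y h ω‖ ≤ ε * h ^ (1 / lam)) := by
  have key : ∀ᵐ ω ∂P, Tendsto
        (fun h : ℝ => h ^ (-(1 / lam)) * sSup ((fun s => ‖Y s ω‖) '' Set.Icc 0 h))
        (nhdsWithin 0 (Set.Ioi 0)) (nhds 0) := by
    obtain ⟨m, hm1, hm2⟩ := exists_between hlam'_lt
    have hm : 0 < m := hlam'.trans hm1
    have hm1i : 0 < 1 / m := by positivity
    have hexp : 0 < 1 / m - 1 / lam := sub_pos.2 (one_div_lt_one_div_of_lt hm hm2)
    have hexp2 : 0 < 1 - lam' / m := sub_pos.2 ((div_lt_one hm).2 hm1)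
    set x : ℕ → ℝ := fun n => (1 / 2 : ℝ) ^ n with hx
    have hx0 : ∀ n, 0 < x n := fun n => by positivity
    have hx1 : ∀ n, x n ≤ 1 := fun n => pow_le_one₀ (by norm_num) (by norm_num)
    have hxt : Tendsto x atTop (nhds 0) :=
      tendsto_pow_atTop_nhds_zero_of_lt_one (by norm_num) (by norm_num)
    set R : ℕ → ℝ := fun n => x n ^ (1 / m) with hR
    have hR0 : ∀ n, 0 < R n := fun n => Real.rpow_pos_of_pos (hx0 n) _
    have hR1 : ∀ n, R n ≤ 1 := fun n => Real.rpow_le_one (hx0 n).le (hx1 n) hm1i.le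
    have hRt : Tendsto R atTop (nhdsWithin 0 (Set.Ioi 0)) := by
      refine tendsto_nhdsWithin_iff.2 ⟨?_, Eventually.of_forall hR0⟩
      have := hxt.rpow_const (p := 1 / m) (Or.inr hm1i.le)
      rwa [Real.zero_rpow hm1i.ne'] at this
    have hev : ∀ᶠ n in atTop, R n ^ lam' * H (R n) < 1 :=
      (hH_limsup.comp hRt).eventually (gt_mem_nhds one_pos)
    obtain ⟨N, hN⟩ := eventually_atTop.1 hev
    set q : ℝ := (1 / 2 : ℝ) ^ (1 - lam' / m) with hq
    have hq0 : 0 < q := Real.rpow_pos_of_pos (by norm_num) _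
    have hq1 : q < 1 := Real.rpow_lt_one (by norm_num) (by norm_num) hexp2
    have hb : ∀ n, N ≤ n → c * x n * H (R n) ≤ c * q ^ n := by
      intro n hn
      have h1 := (hN n hn).le
      have h2 : q ^ n = x n * (R n ^ lam')⁻¹ := by
        rw [hR, ← Real.rpow_mul (hx0 n).le, ← Real.rpow_neg (hx0 n).le]
        nth_rewrite 1 [← Real.rpow_one (x n)]
        rw [← Real.rpow_add (hx0 n), hq, hx]
        simp only
        rw [← Real.rpow_natCast, ← Real.rpow_natCast, ← Real.rpow_mul (by norm_num),
          ← Real.rpow_mul (by norm_num)]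
        congr 1
        ring
      have h3 : 0 < R n ^ lam' := Real.rpow_pos_of_pos (hR0 n) _
      have h4 : H (R n) ≤ (R n ^ lam')⁻¹ := by
        rw [← one_div, le_div_iff₀ h3]
        linarith
      rw [h2, mul_assoc]
      have := (hx0 n).le
      gcongr
    have hsum : Summable (fun n : ℕ => c * q ^ (n + N)) := by
      have := ((summable_geometric_of_lt_one hq0.le hq1).mul_left c)
      exact (summable_nat_add_iff N).2 this
    have hBC := ae_eventually_notMem (μ := P)
      (s := fun n => {ω | R (n + N) ≤ sSup ((fun s => ‖Y s ω‖) '' Set.Icc 0 (x (n + N)))})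
      (by
        refine ne_top_of_le_ne_top hsum.tsum_ofReal_ne_top (ENNReal.tsum_le_tsum fun n => ?_)
        exact (hbound _ _ (hx0 _) (hR0 _) (hR1 _)).trans
          (ENNReal.ofReal_le_ofReal (hb _ (Nat.le_add_left _ _))))
    filter_upwards [hBC] with ω hω
    obtain ⟨M, hM⟩ := eventually_atTop.1 hω
    -- local boundedness near zero
    have hloc : ∀ᶠ s in nhdsWithin (0:ℝ) (Set.Ici 0), ‖Y s ω‖ < ‖Y 0 ω‖ + 1 :=
      (hY_rc ω 0 le_rfl).norm.eventually (gt_mem_nhds (by linarith))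
    obtain ⟨r, hr, hrs⟩ := mem_nhdsGE_iff_exists_Ico_subset.1 hloc
    have hr : 0 < r := hr
    obtain ⟨K, hK⟩ := eventually_atTop.1 (hxt.eventually (gt_mem_nhds hr))
    set L := max K (M + N) with hL
    have hlim : Tendsto (fun h : ℝ => (2:ℝ) ^ (1 / m) * h ^ (1 / m - 1 / lam))
        (nhdsWithin 0 (Set.Ioi 0)) (nhds 0) := by
      have h1 : Tendsto (fun h : ℝ => h) (nhdsWithin 0 (Set.Ioi 0)) (nhds 0) :=
        tendsto_nhdsWithin_of_tendsto_nhds tendsto_id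
      have h2 := (h1.rpow_const (p := 1 / m - 1 / lam) (Or.inr hexp.le)).const_mul ((2:ℝ) ^ (1 / m))
      rwa [Real.zero_rpow hexp.ne', mul_zero] at h2
    refine squeeze_zero' ?_ ?_ hlim
    · filter_upwards [self_mem_nhdsWithin] with h hh
      have hh : 0 < h := hh
      refine mul_nonneg (Real.rpow_nonneg hh.le _) (Real.sSup_nonneg ?_)
      rintro _ ⟨s, -, rfl⟩
      exact norm_nonneg _
    · filter_upwards [Ioo_mem_nhdsGT (hx0 L)] with h hh
      obtain ⟨hh0, hhL⟩ := hh
      obtain ⟨n, hn1, hn2⟩ := exists_nat_pow_near_of_lt_one hh0 (hhL.le.trans (hx1 L))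
        (by norm_num : (0:ℝ) < 1 / 2) (by norm_num)
      have hLn : L ≤ n := by
        by_contra hcon
        have : x L ≤ x (n + 1) :=
          pow_le_pow_of_le_one (by norm_num) (by norm_num) (by omega)
        have h' : x (n + 1) < h := hn1
        linarith
      have hnot := hM (n - N) (by omega)
      rw [Nat.sub_add_cancel (by omega)] at hnot
      simp only [Set.mem_setOf_eq, not_le] at hnot
      have hbdd : BddAbove ((fun s => ‖Y s ω‖) '' Set.Icc 0 (x n)) := by
        refine ⟨‖Y 0 ω‖ + 1, ?_⟩
        rintro _ ⟨s, hs, rfl⟩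
        have : s ∈ Set.Ico 0 r := ⟨hs.1, hs.2.trans_lt (hK n (by omega))⟩
        exact le_of_lt (hrs this)
      have hmono : sSup ((fun s => ‖Y s ω‖) '' Set.Icc 0 h) ≤
          sSup ((fun s => ‖Y s ω‖) '' Set.Icc 0 (x n)) :=
        csSup_le_csSup hbdd ⟨_, ⟨0, ⟨le_rfl, hh0.le⟩, rfl⟩⟩
          (Set.image_mono (Set.Icc_subset_Icc_right hn2))
      have hRn : R n ≤ (2:ℝ) ^ (1 / m) * h ^ (1 / m) := by
        rw [← Real.mul_rpow (by norm_num) hh0.le]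
        refine Real.rpow_le_rpow (hx0 n).le ?_ hm1i.le
        have : x (n + 1) < h := hn1
        have h2 : x (n + 1) = x n * (1 / 2) := pow_succ _ _
        linarith
      calc h ^ (-(1 / lam)) * sSup ((fun s => ‖Y s ω‖) '' Set.Icc 0 h)
          ≤ h ^ (-(1 / lam)) * ((2:ℝ) ^ (1 / m) * h ^ (1 / m)) :=
            mul_le_mul_of_nonneg_left ((hmono.trans hnot.le).trans hRn) (Real.rpow_nonneg hh0.le _)
        _ = (2:ℝ) ^ (1 / m) * h ^ (1 / m - 1 / lam) := by
            rw [sub_eq_add_neg, Real.rpow_add hh0]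
            ring
  refine ⟨key, ?_⟩
  filter_upwards [key, hY0] with ω hω h0 ε hε
  have hloc : ∀ᶠ s in nhdsWithin (0:ℝ) (Set.Ici 0), ‖Y s ω‖ < ‖Y 0 ω‖ + 1 :=
    (hY_rc ω 0 le_rfl).norm.eventually (gt_mem_nhds (by linarith))
  obtain ⟨r, hr, hrs⟩ := mem_nhdsGE_iff_exists_Ico_subset.1 hloc
  have hr : 0 < r := hr
  obtain ⟨u, hu, hus⟩ := mem_nhdsGT_iff_exists_Ioo_subset.1 (hω.eventually (gt_mem_nhds hε))
  have hu : 0 < u := hu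
  have hmin : 0 < min r u := lt_min hr hu
  refine ⟨min r u / 2, by positivity, fun h hh => ?_⟩
  rcases hh.1.eq_or_lt with h00 | hpos
  · rw [← h00, h0, norm_zero]
    exact mul_nonneg hε.le (Real.rpow_nonneg le_rfl _)
  · have hlt : h < min r u := by linarith [hh.2]
    have h1 : h ^ (-(1 / lam)) * sSup ((fun s => ‖Y s ω‖) '' Set.Icc 0 h) < ε :=
      hus ⟨hpos, hlt.trans_le (min_le_right _ _)⟩
    have hbdd : BddAbove ((fun s => ‖Y s ω‖) '' Set.Icc 0 h) := by
      refine ⟨‖Y 0 ω‖ + 1, ?_⟩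
      rintro _ ⟨s, hs, rfl⟩
      have : s ∈ Set.Ico 0 r := ⟨hs.1, hs.2.trans_lt (hlt.trans_le (min_le_left _ _))⟩
      exact le_of_lt (hrs this)
    have h2 : ‖Y h ω‖ ≤ sSup ((fun s => ‖Y s ω‖) '' Set.Icc 0 h) :=
      le_csSup hbdd ⟨h, ⟨hpos.le, le_rfl⟩, rfl⟩
    rw [Real.rpow_neg hpos.le, inv_mul_lt_iff₀ (Real.rpow_pos_of_pos hpos _)] at h1
    linarith
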